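/- Let u ∈ C^{2,1}(Q̄_T) be an admissible solution of equation (E) with u ≥ u̲ on Q̄_T, where u̲ satisfies (sub) with constant δ₀ > 0. Assume (f1), (f2), (A2) and (A4). Then there exists a constant θ > 0, depending only on δ₀ and u̲, such that at every point of Q_T one has 𝓛(u̲ − u) ≥ θ (1 + Σ_i F^{ii}), where Σ_i F^{ii} denotes the trace of the matrix (F^{ij}) = (∂F/∂h_{ij}) evaluated at U[u]. -/

import Mathlib

open scoped BigOperators Topology

noncomputable section

namespace ParabolicHessian

/-- Square real matrices of size `n`. -/
abbrev Mat (n : ℕ) := Matrix (Fin n) (Fin n) ℝ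

/-- Eigenvalue vector of a real matrix (junk value `0` if not symmetric). -/
def eigenVec {n : ℕ} (S : Mat n) : Fin n → ℝ :=
  if h : S.IsHermitian then h.eigenvalues else 0

/-- Spatial gradient of `v : ℝⁿ → ℝ`. -/
def sgrad {n : ℕ} (v : (Fin n → ℝ) → ℝ) (x : Fin n → ℝ) : Fin n → ℝ :=
  fun i => fderiv ℝ v x (Pi.single i 1)

/-- Spatial Hessian of `v : ℝⁿ → ℝ`, as a matrix. -/
def shess {n : ℕ} (v : (Fin n → ℝ) → ℝ) (x : Fin n → ℝ) : Mat n :=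
  Matrix.of fun i j => fderiv ℝ (fun y => fderiv ℝ v y (Pi.single j 1)) x (Pi.single i 1)

/-- Quadratic form `ξᵀ S ξ`. -/
def qform {n : ℕ} (S : Mat n) (ξ : Fin n → ℝ) : ℝ :=
  ∑ i, ∑ j, ξ i * S i j * ξ j

/-- Norm of a matrix (sup norm on `Fin n → Fin n → ℝ`). -/
def matNorm {n : ℕ} (S : Mat n) : ℝ := ‖(fun i j => S i j : Fin n → Fin n → ℝ)‖

/-- The parabolic cylinder `Q_T = Ω × (0,T]`. -/
def QT {n : ℕ} (Ω : Set (Fin n → ℝ)) (T : ℝ) : Set ((Fin n → ℝ) × ℝ) :=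
  Ω ×ˢ Set.Ioc 0 T

/-- `Q̄_T = Ω̄ × [0,T]`. -/
def QTbar {n : ℕ} (Ω : Set (Fin n → ℝ)) (T : ℝ) : Set ((Fin n → ℝ) × ℝ) :=
  closure Ω ×ˢ Set.Icc 0 T

/-- The parabolic boundary `𝒫Q_T = (Ω̄ × {0}) ∪ (∂Ω × [0,T])`. -/
def PQ {n : ℕ} (Ω : Set (Fin n → ℝ)) (T : ℝ) : Set ((Fin n → ℝ) × ℝ) :=
  (closure Ω ×ˢ ({0} : Set ℝ)) ∪ (frontier Ω ×ˢ Set.Icc 0 T)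

/-- `Ω` has smooth boundary (encoded via a smooth defining function). -/
def SmoothBoundary {n : ℕ} (Ω : Set (Fin n → ℝ)) : Prop :=
  ∃ ρ : (Fin n → ℝ) → ℝ, ContDiff ℝ (⊤ : ℕ∞) ρ ∧ Ω = {x | ρ x < 0} ∧
    ∀ x ∈ frontier Ω, fderiv ℝ ρ x ≠ 0

/-- `Γ` is an open convex symmetric proper cone with vertex `0`
containing the positive cone. -/
def GoodCone {n : ℕ} (Γ : Set (Fin n → ℝ)) : Prop :=
  IsOpen Γ ∧ Convex ℝ Γ ∧ (∀ lam ∈ Γ, ∀ s : ℝ, 0 < s → s • lam ∈ Γ) ∧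
    (∀ σ : Equiv.Perm (Fin n), ∀ lam ∈ Γ, lam ∘ σ ∈ Γ) ∧
    {lam : Fin n → ℝ | ∀ i, 0 < lam i} ⊆ Γ ∧ Γ ≠ Set.univ

/-- `f` is smooth and symmetric on `Γ`. -/
def SmoothSymF {n : ℕ} (Γ : Set (Fin n → ℝ)) (f : (Fin n → ℝ) → ℝ) : Prop :=
  ContDiffOn ℝ (⊤ : ℕ∞) f Γ ∧ ∀ σ : Equiv.Perm (Fin n), ∀ lam ∈ Γ, f (lam ∘ σ) = f lam

/-- `f_i = ∂f/∂λ_i`. -/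
def fLam {n : ℕ} (f : (Fin n → ℝ) → ℝ) (lam : Fin n → ℝ) (i : Fin n) : ℝ :=
  fderiv ℝ f lam (Pi.single i 1)

/-- (f1): `∂f/∂λ_i > 0` on `Γ`. -/
def F1cond {n : ℕ} (Γ : Set (Fin n → ℝ)) (f : (Fin n → ℝ) → ℝ) : Prop :=
  ∀ lam ∈ Γ, ∀ i, 0 < fLam f lam i

/-- (f2): `f` is concave on `Γ`. -/
def F2cond {n : ℕ} (Γ : Set (Fin n → ℝ)) (f : (Fin n → ℝ) → ℝ) : Prop :=
  ConcaveOn ℝ Γ f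

/-- (f5): `f > 0` on `Γ` and `f → 0` at every boundary point of `Γ`. -/
def F5cond {n : ℕ} (Γ : Set (Fin n → ℝ)) (f : (Fin n → ℝ) → ℝ) : Prop :=
  (∀ lam ∈ Γ, 0 < f lam) ∧
    ∀ lam₀ ∈ frontier Γ, Filter.Tendsto f (nhdsWithin lam₀ Γ) (nhds 0)

/-- `A(x,t,p)` is a smooth symmetric-matrix-valued function. -/
def ASmooth {n : ℕ} (A : (Fin n → ℝ) → ℝ → (Fin n → ℝ) → Mat n) : Prop :=
  (∀ x t p, (A x t p).IsSymm) ∧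
    ∀ i j, ContDiff ℝ (⊤ : ℕ∞)
      (fun q : ((Fin n → ℝ) × ℝ) × (Fin n → ℝ) => A q.1.1 q.1.2 q.2 i j)

/-- `ψ(x,t,z,p)` is smooth. -/
def PsiSmooth {n : ℕ} (ψ : (Fin n → ℝ) → ℝ → ℝ → (Fin n → ℝ) → ℝ) : Prop :=
  ContDiff ℝ (⊤ : ℕ∞)
    (fun q : ((Fin n → ℝ) × ℝ) × ℝ × (Fin n → ℝ) => ψ q.1.1 q.1.2 q.2.1 q.2.2)

/-- `u ∈ C^k`, jointly in `(x,t)`. -/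
def RegN {n : ℕ} (k : ℕ) (u : (Fin n → ℝ) → ℝ → ℝ) : Prop :=
  ContDiff ℝ (k : ℕ∞) fun q : (Fin n → ℝ) × ℝ => u q.1 q.2

/-- `u ∈ C^∞`, jointly in `(x,t)`. -/
def RegInf {n : ℕ} (u : (Fin n → ℝ) → ℝ → ℝ) : Prop :=
  ContDiff ℝ (⊤ : ℕ∞) fun q : (Fin n → ℝ) × ℝ => u q.1 q.2

/-- `U[u] = D²u + A(x,t,Du)`. -/
def Umat {n : ℕ} (A : (Fin n → ℝ) → ℝ → (Fin n → ℝ) → Mat n)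
    (u : (Fin n → ℝ) → ℝ → ℝ) (x : Fin n → ℝ) (t : ℝ) : Mat n :=
  shess (fun y => u y t) x + A x t (sgrad (fun y => u y t) x)

/-- `u` is admissible on `Q`: `λ(U[u]) ∈ Γ` on `Q`. -/
def Admissible {n : ℕ} (Γ : Set (Fin n → ℝ))
    (A : (Fin n → ℝ) → ℝ → (Fin n → ℝ) → Mat n)
    (u : (Fin n → ℝ) → ℝ → ℝ) (Q : Set ((Fin n → ℝ) × ℝ)) : Prop :=
  ∀ q ∈ Q, eigenVec (Umat A u q.1 q.2) ∈ Γ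

/-- Equation (E): `f(λ(D²u + A(x,t,Du))) − ∂ₜu = ψ(x,t,u,Du)` on `Q`. -/
def SolvesE {n : ℕ} (f : (Fin n → ℝ) → ℝ)
    (A : (Fin n → ℝ) → ℝ → (Fin n → ℝ) → Mat n)
    (ψ : (Fin n → ℝ) → ℝ → ℝ → (Fin n → ℝ) → ℝ)
    (u : (Fin n → ℝ) → ℝ → ℝ) (Q : Set ((Fin n → ℝ) × ℝ)) : Prop :=
  ∀ q ∈ Q, f (eigenVec (Umat A u q.1 q.2)) - deriv (u q.1) q.2
    = ψ q.1 q.2 (u q.1 q.2) (sgrad (fun y => u y q.2) q.1)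

/-- (A2): `−ψ` and `ξᵀAξ` are concave in `p`. -/
def A2cond {n : ℕ} (A : (Fin n → ℝ) → ℝ → (Fin n → ℝ) → Mat n)
    (ψ : (Fin n → ℝ) → ℝ → ℝ → (Fin n → ℝ) → ℝ) : Prop :=
  (∀ x t z, ConcaveOn ℝ Set.univ fun p : Fin n → ℝ => -(ψ x t z p)) ∧
    ∀ x t (ξ : Fin n → ℝ), ConcaveOn ℝ Set.univ fun p => qform (A x t p) ξ

/-- (A4): `ψ_z ≤ 0`. -/
def A4cond {n : ℕ} (ψ : (Fin n → ℝ) → ℝ → ℝ → (Fin n → ℝ) → ℝ) : Prop :=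
  ∀ x t z p, deriv (fun w => ψ x t w p) z ≤ 0

/-- (sub): `u̲` is an admissible strict subsolution with gap `δ₀` on `Q`. -/
def Subsol {n : ℕ} (Γ : Set (Fin n → ℝ)) (f : (Fin n → ℝ) → ℝ)
    (A : (Fin n → ℝ) → ℝ → (Fin n → ℝ) → Mat n)
    (ψ : (Fin n → ℝ) → ℝ → ℝ → (Fin n → ℝ) → ℝ) (δ₀ : ℝ)
    (ub : (Fin n → ℝ) → ℝ → ℝ) (Q : Set ((Fin n → ℝ) × ℝ)) : Prop :=
  Admissible Γ A ub Q ∧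
    ∀ q ∈ Q, f (eigenVec (Umat A ub q.1 q.2)) - deriv (ub q.1) q.2
      ≥ ψ q.1 q.2 (ub q.1 q.2) (sgrad (fun y => ub y q.2) q.1) + δ₀

/-- `F(h) := f(λ(h))` (extended to all of matrix space by symmetrizing `h`). -/
def Ffunc {n : ℕ} (f : (Fin n → ℝ) → ℝ) (h : Fin n → Fin n → ℝ) : ℝ :=
  f (eigenVec (Matrix.of fun i j => (h i j + h j i) / 2))

/-- `F^{ij} = ∂F/∂h_{ij}`, evaluated at the matrix `U`. -/
def Fmat {n : ℕ} (f : (Fin n → ℝ) → ℝ) (U : Mat n) : Mat n :=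
  Matrix.of fun i j =>
    fderiv ℝ (Ffunc f) (fun a b => U a b) (Pi.single i (Pi.single j 1))

/-- The linearized operator
`𝓛v = Σ F^{ij} ∂²v/∂x_i∂x_j + Σ_k (Σ F^{ij} ∂A^{ij}/∂p_k − ψ_{p_k}) ∂v/∂x_k − ∂ₜv`,
where the coefficients are evaluated at `u`. -/
def Lop {n : ℕ} (f : (Fin n → ℝ) → ℝ)
    (A : (Fin n → ℝ) → ℝ → (Fin n → ℝ) → Mat n)
    (ψ : (Fin n → ℝ) → ℝ → ℝ → (Fin n → ℝ) → ℝ)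
    (u v : (Fin n → ℝ) → ℝ → ℝ) (x : Fin n → ℝ) (t : ℝ) : ℝ :=
  (∑ i, ∑ j, Fmat f (Umat A u x t) i j * shess (fun y => v y t) x i j)
    + (∑ k, ((∑ i, ∑ j, Fmat f (Umat A u x t) i j *
          fderiv ℝ (fun p => A x t p i j) (sgrad (fun y => u y t) x) (Pi.single k 1))
        - fderiv ℝ (fun p => ψ x t (u x t) p) (sgrad (fun y => u y t) x) (Pi.single k 1))
        * sgrad (fun y => v y t) x k)
    - deriv (v x) t

/-- Pointwise bound for the `C¹_x` norm `|u| + |Du|` on `Q`. -/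
def C1xBound {n : ℕ} (u : (Fin n → ℝ) → ℝ → ℝ) (Q : Set ((Fin n → ℝ) × ℝ)) (K : ℝ) : Prop :=
  ∀ q ∈ Q, |u q.1 q.2| + ‖sgrad (fun y => u y q.2) q.1‖ ≤ K

/-- Pointwise bound for the `C²` norm `|v| + |Dv| + |D²v| + |∂ₜv|` on `Q`. -/
def C2Bound {n : ℕ} (v : (Fin n → ℝ) → ℝ → ℝ) (Q : Set ((Fin n → ℝ) × ℝ)) (K : ℝ) : Prop :=
  ∀ q ∈ Q, |v q.1 q.2| + ‖sgrad (fun y => v y q.2) q.1‖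
    + matNorm (shess (fun y => v y q.2) q.1) + |deriv (v q.1) q.2| ≤ K

/-- Bound `K` for all derivatives of `φ` of order ≤ `k₀` on `Q`. -/
def CkBound {n : ℕ} (k₀ : ℕ) (φ : (Fin n → ℝ) → ℝ → ℝ)
    (Q : Set ((Fin n → ℝ) × ℝ)) (K : ℝ) : Prop :=
  ∀ q ∈ Q, ∀ k : ℕ, k ≤ k₀ →
    ‖iteratedFDeriv ℝ k (fun p : (Fin n → ℝ) × ℝ => φ p.1 p.2) q‖ ≤ K

/-- First half of (A1): `p·∇_x(ξᵀAξ) ≤ ψ̄₁(x,t)|ξ|²(1+|p|^{γ₁})`. -/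
def A1a {n : ℕ} (A : (Fin n → ℝ) → ℝ → (Fin n → ℝ) → Mat n)
    (ψb1 : (Fin n → ℝ) → ℝ → ℝ) (γ₁ : ℝ) (Ω : Set (Fin n → ℝ)) (T : ℝ) : Prop :=
  ∀ x ∈ closure Ω, ∀ t ∈ Set.Icc (0 : ℝ) T, ∀ p ξ : Fin n → ℝ,
    fderiv ℝ (fun y => qform (A y t p) ξ) x p ≤ ψb1 x t * ‖ξ‖ ^ 2 * (1 + ‖p‖ ^ γ₁)

/-- Second half of (A1): `p·∇_xψ + |p|²ψ_z ≥ −ψ̄₂(x,t,z)(1+|p|^{γ₂})`. -/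
def A1b {n : ℕ} (ψ : (Fin n → ℝ) → ℝ → ℝ → (Fin n → ℝ) → ℝ)
    (ψb2 : (Fin n → ℝ) → ℝ → ℝ → ℝ) (γ₂ : ℝ) (Ω : Set (Fin n → ℝ)) (T : ℝ) : Prop :=
  ∀ x ∈ closure Ω, ∀ t ∈ Set.Icc (0 : ℝ) T, ∀ z : ℝ, ∀ p : Fin n → ℝ,
    fderiv ℝ (fun y => ψ y t z p) x p + ‖p‖ ^ 2 * deriv (fun w => ψ x t w p) z
      ≥ -(ψb2 x t z * (1 + ‖p‖ ^ γ₂))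

/-- (A3): strict concavity of `p ↦ ξᵀA(x,t,p)ξ`. -/
def A3cond {n : ℕ} (A : (Fin n → ℝ) → ℝ → (Fin n → ℝ) → Mat n) (c₀ : ℝ) : Prop :=
  ∀ x t (p ξ η : Fin n → ℝ),
    fderiv ℝ (fun q => fderiv ℝ (fun r => qform (A x t r) ξ) q η) p η
      ≤ -c₀ * ‖ξ‖ ^ 2 * ‖η‖ ^ 2 + c₀ * (∑ i, ξ i * η i) ^ 2

theorem _root_.ConcaveOn.le_add_of_hasFDerivAt {E : Type*} [NormedAddCommGroup E]
    [NormedSpace ℝ E] {s : Set E} {φ : E → ℝ} {φ' : E →L[ℝ] ℝ} {x y : E}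
    (hφ : ConcaveOn ℝ s φ) (hx : x ∈ s) (hy : y ∈ s) (hd : HasFDerivAt φ φ' x) :
    φ y ≤ φ x + φ' (y - x) := by
  have hc := hφ.comp_affineMap (AffineMap.lineMap (k := ℝ) x y)
  have hd' : HasDerivAt (φ ∘ AffineMap.lineMap (k := ℝ) x y) (φ' (y - x)) 0 := by
    have h0 : HasFDerivAt φ φ' (AffineMap.lineMap (k := ℝ) x y 0) := by simpa using hd
    exact h0.comp_hasDerivAt (0 : ℝ) AffineMap.hasDerivAt_lineMap
  have h := hc.slope_le_of_hasDerivAt (x := 0) (y := 1) (by simpa using hx) (by simpa using hy)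
    one_pos hd'
  simp [slope_def_field] at h
  rw [map_sub]
  linarith

theorem exists_perm_of_map_univ_eq {ι α : Type*} [Fintype ι] {a b : ι → α}
    (h : Multiset.map a Finset.univ.val = Multiset.map b Finset.univ.val) :
    ∃ σ : Equiv.Perm ι, a = b ∘ σ := by
  classical
  have hc : ∀ c, Fintype.card {i // a i = c} = Fintype.card {i // b i = c} := by
    intro c
    have := congrArg (Multiset.count c) h
    rw [Multiset.count_map, Multiset.count_map] at this
    rw [Fintype.card_subtype, Fintype.card_subtype, Finset.card_def, Finset.card_def,
      Finset.filter_val, Finset.filter_val]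
    simpa only [eq_comm] using this
  refine ⟨Equiv.ofFiberEquiv fun c => Fintype.equivOfCardEq (hc c), ?_⟩
  funext i
  exact (Equiv.ofFiberEquiv_map _ i).symm

/-- `V = R diag(μ) Rᵀ` with `R` orthogonal. -/
def Diagonalizes {n : ℕ} (V R : Mat n) (μ : Fin n → ℝ) : Prop :=
  R.transpose * R = 1 ∧ V = R * Matrix.diagonal μ * R.transpose

namespace Diagonalizes

variable {n : ℕ} {V R : Mat n} {μ : Fin n → ℝ}

theorem mul_transpose (h : Diagonalizes V R μ) : R * R.transpose = 1 :=
  mul_eq_one_comm.mp h.1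

theorem conj_eq (h : Diagonalizes V R μ) : R.transpose * V * R = Matrix.diagonal μ := by
  rw [h.2]
  calc R.transpose * (R * Matrix.diagonal μ * R.transpose) * R
      = (R.transpose * R) * Matrix.diagonal μ * (R.transpose * R) := by
        simp only [Matrix.mul_assoc]
    _ = _ := by rw [h.1]; simp

theorem isSymm (h : Diagonalizes V R μ) : V.IsSymm := by
  rw [Matrix.IsSymm, h.2]
  simp [Matrix.mul_assoc]

theorem exists_perm (h : Diagonalizes V R μ) : ∃ σ : Equiv.Perm (Fin n), eigenVec V = μ ∘ σ := by
  have hV : V.IsHermitian := by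
    rw [Matrix.IsHermitian, Matrix.conjTranspose_eq_transpose_of_trivial]
    exact h.isSymm
  rw [eigenVec, dif_pos hV]
  apply exists_perm_of_map_univ_eq
  have h1 := hV.roots_charpoly_eq_eigenvalues
  have h2 : V.charpoly = (Matrix.diagonal μ).charpoly := by
    rw [h.2, Matrix.charpoly_mul_comm, ← mul_assoc, h.1, one_mul]
  have h3 : V.charpoly.roots = Multiset.map μ Finset.univ.val := by
    rw [h2, Matrix.charpoly_diagonal, Polynomial.roots_prod]
    · simp
    · simp [Finset.prod_ne_zero_iff, Polynomial.X_sub_C_ne_zero]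
  rw [← h3, h1]
  rfl

theorem add_smul_one (h : Diagonalizes V R μ) (s : ℝ) :
    Diagonalizes (V + s • 1) R (μ + fun _ => s) := by
  refine ⟨h.1, ?_⟩
  have : Matrix.diagonal (μ + fun _ => s) = Matrix.diagonal μ + s • (1 : Mat n) := by
    ext i j
    by_cases hij : i = j <;> simp [Matrix.diagonal, hij]
  rw [this, mul_add, add_mul, ← h.2]
  simp [h.mul_transpose]

end Diagonalizes

theorem exists_diagonalizes_eigenVec {n : ℕ} {V : Mat n} (hV : V.IsSymm) :
    ∃ R, Diagonalizes V R (eigenVec V) := by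
  have hH : V.IsHermitian := by
    rw [Matrix.IsHermitian, Matrix.conjTranspose_eq_transpose_of_trivial]
    exact hV
  refine ⟨hH.eigenvectorUnitary, ?_, ?_⟩
  · have := Unitary.star_mul_self_of_mem hH.eigenvectorUnitary.2
    rwa [Matrix.star_eq_conjTranspose, Matrix.conjTranspose_eq_transpose_of_trivial] at this
  · have := hH.spectral_theorem
    rw [Unitary.conjStarAlgAut_apply, Matrix.star_eq_conjTranspose,
      Matrix.conjTranspose_eq_transpose_of_trivial] at this
    rw [eigenVec, dif_pos hH]
    exact this

theorem GoodCone.comp_mem_iff {n : ℕ} {Γ : Set (Fin n → ℝ)} (hΓ : GoodCone Γ)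
    (σ : Equiv.Perm (Fin n)) {μ : Fin n → ℝ} : μ ∘ σ ∈ Γ ↔ μ ∈ Γ := by
  refine ⟨fun h => ?_, hΓ.2.2.2.1 σ μ⟩
  simpa [Function.comp_assoc] using hΓ.2.2.2.1 σ⁻¹ _ h

theorem Diagonalizes.mem_iff {n : ℕ} {V R : Mat n} {μ : Fin n → ℝ} (h : Diagonalizes V R μ)
    {Γ : Set (Fin n → ℝ)} (hΓ : GoodCone Γ) : eigenVec V ∈ Γ ↔ μ ∈ Γ := by
  obtain ⟨σ, hσ⟩ := h.exists_perm
  rw [hσ, hΓ.comp_mem_iff]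

theorem Diagonalizes.apply_eigenVec {n : ℕ} {V R : Mat n} {μ : Fin n → ℝ}
    (h : Diagonalizes V R μ) {Γ : Set (Fin n → ℝ)} {f : (Fin n → ℝ) → ℝ}
    (hf : SmoothSymF Γ f) (hμ : μ ∈ Γ) : f (eigenVec V) = f μ := by
  obtain ⟨σ, hσ⟩ := h.exists_perm
  rw [hσ, hf.2 σ μ hμ]

/-- The gradient of the spectral function of `f` at `R diag(μ) Rᵀ`. -/
def specGrad {n : ℕ} (f : (Fin n → ℝ) → ℝ) (R : Mat n) (μ : Fin n → ℝ) : Mat n :=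
  R * Matrix.diagonal (fLam f μ) * R.transpose

theorem sum_conj_diagonal_mul {n : ℕ} (R X : Mat n) (g : Fin n → ℝ) :
    ∑ i, ∑ j, (R * Matrix.diagonal g * R.transpose) i j * X i j
      = ∑ m, g m * (R.transpose * X * R) m m := by
  have hM : ∀ i j, (R * Matrix.diagonal g * R.transpose) i j = ∑ m, R i m * g m * R j m := by
    intro i j
    rw [Matrix.mul_apply]
    simp [Matrix.mul_diagonal]
  simp only [hM, Matrix.mul_apply, Matrix.transpose_apply, Finset.sum_mul, Finset.mul_sum]
  rw [Finset.sum_congr rfl fun i _ => Finset.sum_comm, Finset.sum_comm]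
  refine Finset.sum_congr rfl fun m _ => ?_
  rw [Finset.sum_comm]
  refine Finset.sum_congr rfl fun j _ => Finset.sum_congr rfl fun i _ => ?_
  ring

theorem conj_apply_eq_qform {n : ℕ} (R X : Mat n) (m : Fin n) :
    (R.transpose * X * R) m m = qform X fun i => R i m := by
  simp only [Matrix.mul_apply, Matrix.transpose_apply, qform, Finset.sum_mul]
  rw [Finset.sum_comm]

theorem hasFDerivAt_of_mem {n : ℕ} {Γ : Set (Fin n → ℝ)} (hΓ : GoodCone Γ)
    {f : (Fin n → ℝ) → ℝ} (hf : SmoothSymF Γ f) {μ : Fin n → ℝ} (hμ : μ ∈ Γ) :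
    HasFDerivAt f (fderiv ℝ f μ) μ :=
  ((hf.1.contDiffAt (hΓ.1.mem_nhds hμ)).differentiableAt (by simp)).hasFDerivAt

theorem fderiv_eq_sum_fLam {n : ℕ} (f : (Fin n → ℝ) → ℝ) (μ v : Fin n → ℝ) :
    fderiv ℝ f μ v = ∑ i, fLam f μ i * v i := by
  conv_lhs => rw [pi_eq_sum_univ' v]
  rw [map_sum]
  refine Finset.sum_congr rfl fun i _ => ?_
  rw [map_smul, fLam, smul_eq_mul, mul_comm]

theorem fLam_comp_perm {n : ℕ} {Γ : Set (Fin n → ℝ)} (hΓ : GoodCone Γ)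
    {f : (Fin n → ℝ) → ℝ} (hf : SmoothSymF Γ f) (σ : Equiv.Perm (Fin n)) {μ : Fin n → ℝ}
    (hμ : μ ∈ Γ) (j : Fin n) : fLam f (μ ∘ σ) j = fLam f μ (σ j) := by
  let P : (Fin n → ℝ) →L[ℝ] (Fin n → ℝ) := ContinuousLinearMap.pi fun i =>
    ContinuousLinearMap.proj (σ i)
  have hP : ∀ v, P v = v ∘ σ := fun v => rfl
  have h1 : HasFDerivAt f ((fderiv ℝ f (μ ∘ σ)).comp P) μ := by
    have h2 : HasFDerivAt (f ∘ P) ((fderiv ℝ f (μ ∘ σ)).comp P) μ :=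
      (hasFDerivAt_of_mem hΓ hf ((hΓ.comp_mem_iff σ).2 hμ)).comp μ P.hasFDerivAt
    refine h2.congr_of_eventuallyEq ?_
    filter_upwards [hΓ.1.mem_nhds hμ] with v hv
    rw [Function.comp_apply, hP, hf.2 σ v hv]
  rw [fLam, fLam, h1.fderiv, ContinuousLinearMap.comp_apply, hP]
  congr 1
  ext i
  simp [Pi.single_apply]

theorem Diagonalizes.apply_le {n : ℕ} {Γ : Set (Fin n → ℝ)} (hΓ : GoodCone Γ)
    {f : (Fin n → ℝ) → ℝ} (hf : SmoothSymF Γ f) (hf2 : F2cond Γ f) {U R V S : Mat n}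
    {μ ν : Fin n → ℝ} (hU : Diagonalizes U R μ) (hV : Diagonalizes V S ν)
    (hμ : μ ∈ Γ) (hν : ν ∈ Γ) :
    f ν ≤ f μ + ∑ i, ∑ j, specGrad f R μ i j * (V i j - U i j) := by
  set W : Mat n := R.transpose * S with hW
  have hWW : W * W.transpose = 1 := by
    rw [hW, Matrix.transpose_mul, Matrix.transpose_transpose]
    calc R.transpose * S * (S.transpose * R) = R.transpose * (S * S.transpose) * R := by
          simp only [Matrix.mul_assoc]
      _ = 1 := by rw [hV.mul_transpose, mul_one, hU.1]
  have hWW' : W.transpose * W = 1 := mul_eq_one_comm.mp hWW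
  set M : Mat n := Matrix.of fun i j => W i j ^ 2 with hM
  have hMd : M ∈ doublyStochastic ℝ (Fin n) := by
    rw [mem_doublyStochastic_iff_sum]
    refine ⟨fun i j => sq_nonneg _, fun i => ?_, fun j => ?_⟩
    · have := congrFun (congrFun hWW i) i
      simpa [Matrix.mul_apply, hM, sq] using this
    · have := congrFun (congrFun hWW' j) j
      simpa [Matrix.mul_apply, hM, sq] using this
  have hdiag : ∀ m, (R.transpose * V * R) m m = (M.mulVec ν) m := by
    intro m
    have : R.transpose * V * R = W * Matrix.diagonal ν * W.transpose := by
      rw [hW, hV.2, Matrix.transpose_mul, Matrix.transpose_transpose]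
      simp only [Matrix.mul_assoc]
    rw [this, Matrix.mul_apply]
    simp only [Matrix.mul_diagonal, Matrix.mulVec, dotProduct, hM, Matrix.transpose_apply,
      Matrix.of_apply]
    refine Finset.sum_congr rfl fun j _ => ?_
    ring
  obtain ⟨w, hw0, hw1, hw⟩ := exists_eq_sum_perm_of_mem_doublyStochastic hMd
  have hMν : M.mulVec ν = ∑ σ, w σ • (ν ∘ σ) := by
    rw [← hw, Matrix.sum_mulVec]
    refine Finset.sum_congr rfl fun σ _ => ?_
    rw [Matrix.smul_mulVec, Matrix.permMatrix_mulVec]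
  have hmemσ : ∀ σ : Equiv.Perm (Fin n), ν ∘ σ ∈ Γ := fun σ => (hΓ.comp_mem_iff σ).2 hν
  have hmem : M.mulVec ν ∈ Γ := by
    rw [hMν]
    exact hΓ.2.1.sum_mem (fun σ _ => hw0 σ) hw1 fun σ _ => hmemσ σ
  have hjensen : f ν ≤ f (M.mulVec ν) := by
    have h := hf2.le_map_sum (t := Finset.univ) (fun σ _ => hw0 σ) hw1 fun σ _ => hmemσ σ
    rw [← hMν] at h
    refine le_trans (le_of_eq ?_) h
    simp only [hf.2 _ ν hν, smul_eq_mul, ← Finset.sum_mul, hw1, one_mul]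
  have htan := hf2.le_add_of_hasFDerivAt hμ hmem (hasFDerivAt_of_mem hΓ hf hμ)
  rw [fderiv_eq_sum_fLam] at htan
  have hsum := sum_conj_diagonal_mul R (V - U) (fLam f μ)
  rw [Matrix.mul_sub, Matrix.sub_mul, hU.conj_eq] at hsum
  simp only [Matrix.sub_apply, hdiag, Matrix.diagonal_apply_eq] at hsum
  rw [specGrad, hsum]
  exact hjensen.trans htan

theorem Diagonalizes.specGrad_eq {n : ℕ} {Γ : Set (Fin n → ℝ)} (hΓ : GoodCone Γ)
    {f : (Fin n → ℝ) → ℝ} (hf : SmoothSymF Γ f) {U R S : Mat n}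
    {μ ν : Fin n → ℝ} (hR : Diagonalizes U R μ) (hS : Diagonalizes U S ν) (hμ : μ ∈ Γ) :
    specGrad f S ν = specGrad f R μ := by
  obtain ⟨σ, hσ⟩ : ∃ σ : Equiv.Perm (Fin n), ν = μ ∘ σ := by
    obtain ⟨τ, hτ⟩ := hR.exists_perm
    obtain ⟨τ', hτ'⟩ := hS.exists_perm
    refine ⟨τ * τ'⁻¹, ?_⟩
    have h : ν = eigenVec U ∘ ⇑τ'⁻¹ := by
      rw [hτ']
      ext i
      simp
    rw [h, hτ]
    rfl
  set W : Mat n := R.transpose * S with hW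
  have hWW : W * W.transpose = 1 := by
    rw [hW, Matrix.transpose_mul, Matrix.transpose_transpose]
    calc R.transpose * S * (S.transpose * R) = R.transpose * (S * S.transpose) * R := by
          simp only [Matrix.mul_assoc]
      _ = 1 := by rw [hS.mul_transpose, mul_one, hR.1]
  have hRW : R * W = S := by rw [hW, ← Matrix.mul_assoc, hR.mul_transpose, one_mul]
  have hcomm : Matrix.diagonal μ * W = W * Matrix.diagonal ν := by
    rw [← hR.conj_eq, ← hS.conj_eq]
    calc R.transpose * U * R * W = R.transpose * U * (R * W) := by simp only [Matrix.mul_assoc]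
      _ = R.transpose * (S * S.transpose) * U * S := by rw [hRW, hS.mul_transpose, mul_one]
      _ = W * (S.transpose * U * S) := by rw [hW]; simp only [Matrix.mul_assoc]
  have hcomm' : Matrix.diagonal (fLam f μ) * W = W * Matrix.diagonal (fLam f ν) := by
    ext i j
    have h := congrFun (congrFun hcomm i) j
    rw [Matrix.diagonal_mul, Matrix.mul_diagonal] at h ⊢
    by_cases hij : W i j = 0
    · simp [hij]
    have hμν : μ i = μ (σ j) := by
      have h' : μ i * W i j = ν j * W i j := by rw [h, mul_comm]
      simpa [hσ] using mul_right_cancel₀ hij h'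
    have hswap : μ ∘ Equiv.swap i (σ j) = μ := by
      ext k
      rw [Function.comp_apply, Equiv.swap_apply_def]
      split_ifs with h1 h2
      · rw [h1, hμν]
      · rw [h2, hμν]
      · rfl
    have h1 := fLam_comp_perm hΓ hf (Equiv.swap i (σ j)) hμ i
    rw [hswap, Equiv.swap_apply_left] at h1
    rw [hσ, fLam_comp_perm hΓ hf σ hμ, h1, mul_comm]
  have hWR : W.transpose * R.transpose = S.transpose := by rw [← Matrix.transpose_mul, hRW]
  rw [specGrad, specGrad]
  calc S * Matrix.diagonal (fLam f ν) * S.transpose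
      = R * (W * Matrix.diagonal (fLam f ν)) * W.transpose * R.transpose := by
        rw [← hWR]; nth_rw 1 [← hRW]; simp only [Matrix.mul_assoc]
    _ = R * Matrix.diagonal (fLam f μ) * (W * W.transpose) * R.transpose := by
        rw [← hcomm']; simp only [Matrix.mul_assoc]
    _ = _ := by rw [hWW, mul_one]

theorem isCompact_orthogonal (n : ℕ) : IsCompact {R : Mat n | R.transpose * R = 1} := by
  have hbox : IsCompact (Set.univ.pi fun _ : Fin n => Set.univ.pi fun _ : Fin n =>
      Set.Icc (-1 : ℝ) 1) :=
    isCompact_univ_pi fun _ => isCompact_univ_pi fun _ => isCompact_Icc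
  refine IsCompact.of_isClosed_subset (X := Mat n) hbox ?_ ?_
  · exact isClosed_eq (by fun_prop) continuous_const
  · intro R hR i _ j _
    have h := congrFun (congrFun (show R.transpose * R = 1 from hR) j) j
    rw [Matrix.mul_apply, Matrix.one_apply_eq] at h
    have h1 : R.transpose j i * R i j ≤ 1 := by
      rw [← h]
      exact Finset.single_le_sum (f := fun k => R.transpose j k * R k j)
        (fun k _ => mul_self_nonneg (R k j)) (Finset.mem_univ i)
    rw [Matrix.transpose_apply] at h1
    exact ⟨by nlinarith, by nlinarith⟩

theorem diagonalizes_iff {n : ℕ} {V S : Mat n} {ν : Fin n → ℝ} :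
    Diagonalizes V S ν ↔ S.transpose * S = 1 ∧ S.transpose * V * S = Matrix.diagonal ν := by
  refine ⟨fun h => ⟨h.1, h.conj_eq⟩, fun ⟨h1, h2⟩ => ⟨h1, ?_⟩⟩
  have h3 : S * S.transpose = 1 := mul_eq_one_comm.mp h1
  rw [← h2]
  calc V = (S * S.transpose) * V * (S * S.transpose) := by rw [h3]; simp
    _ = _ := by simp only [Matrix.mul_assoc]

theorem continuousAt_fLam {n : ℕ} {Γ : Set (Fin n → ℝ)} (hΓ : GoodCone Γ)
    {f : (Fin n → ℝ) → ℝ} (hf : SmoothSymF Γ f) {μ : Fin n → ℝ} (hμ : μ ∈ Γ) :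
    ContinuousAt (fLam f) μ := by
  have h : ContinuousAt (fderiv ℝ f) μ :=
    (hf.1.continuousOn_fderiv_of_isOpen hΓ.1 (by simp)).continuousAt (hΓ.1.mem_nhds hμ)
  exact continuousAt_pi.2 fun i => h.clm_apply continuousAt_const

theorem continuousAt_sum_abs_specGrad_sub {n : ℕ} {Γ : Set (Fin n → ℝ)} (hΓ : GoodCone Γ)
    {f : (Fin n → ℝ) → ℝ} (hf : SmoothSymF Γ f) {S : Mat n} {μ : Fin n → ℝ} (hμ : μ ∈ Γ)
    (G : Mat n) :
    ContinuousAt (fun z : Mat n × (Fin n → ℝ) => ∑ i, ∑ j, |specGrad f z.1 z.2 i j - G i j|)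
      (S, μ) := by
  have h1 : ContinuousAt (fun z : Mat n × (Fin n → ℝ) => (z.1, fLam f z.2)) (S, μ) :=
    continuousAt_fst.prodMk (ContinuousAt.comp' (g := fLam f) (f := Prod.snd) (x := (S, μ))
      (continuousAt_fLam hΓ hf hμ) continuousAt_snd)
  have h2 : Continuous fun p : Mat n × (Fin n → ℝ) =>
      p.1 * Matrix.diagonal p.2 * p.1.transpose := by fun_prop
  have h3 : Continuous fun p : Mat n × (Fin n → ℝ) =>
      ∑ i, ∑ j, |(p.1 * Matrix.diagonal p.2 * p.1.transpose) i j - G i j| :=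
    continuous_finsetSum _ fun i _ => continuous_finsetSum _ fun j _ =>
      ((h2.matrix_elem i j).sub continuous_const).abs
  exact ContinuousAt.comp' (f := fun z : Mat n × (Fin n → ℝ) => (z.1, fLam f z.2)) (x := (S, μ))
    h3.continuousAt h1

theorem Diagonalizes.eventually_specGrad_near {n : ℕ} {Γ : Set (Fin n → ℝ)} (hΓ : GoodCone Γ)
    {f : (Fin n → ℝ) → ℝ} (hf : SmoothSymF Γ f) {U R : Mat n} {μ : Fin n → ℝ}
    (hU : Diagonalizes U R μ) (hμ : μ ∈ Γ) {ε : ℝ} (hε : 0 < ε) :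
    ∀ᶠ V in 𝓝 U, ∀ S ν, Diagonalizes V S ν →
      ν ∈ Γ ∧ ∑ i, ∑ j, |specGrad f S ν i j - specGrad f R μ i j| < ε := by
  have key := (isCompact_orthogonal n).eventually_forall_of_forall_eventually (x₀ := U)
    (P := fun V S => S.transpose * V * S = Matrix.diagonal (S.transpose * V * S).diag →
      (S.transpose * V * S).diag ∈ Γ ∧ ∑ i, ∑ j,
        |specGrad f S (S.transpose * V * S).diag i j - specGrad f R μ i j| < ε) ?_
  · filter_upwards [key] with V hV S ν hS
    have h := hV S hS.1
    rw [hS.conj_eq, Matrix.diag_diagonal] at h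
    exact h rfl
  · intro S hS
    have hc : Continuous fun z : Mat n × Mat n => z.2.transpose * z.1 * z.2 := by fun_prop
    have hcd : Continuous fun z : Mat n × Mat n => (z.2.transpose * z.1 * z.2).diag :=
      hc.matrix_diag
    by_cases hd : S.transpose * U * S = Matrix.diagonal (S.transpose * U * S).diag
    · have hD : Diagonalizes U S (S.transpose * U * S).diag := diagonalizes_iff.2 ⟨hS, hd⟩
      have hmem : (S.transpose * U * S).diag ∈ Γ := (hD.mem_iff hΓ).1 ((hU.mem_iff hΓ).2 hμ)
      have hz : Filter.Tendsto
          (fun z : Mat n × Mat n => (z.2, (z.2.transpose * z.1 * z.2).diag)) (𝓝 (U, S))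
          (𝓝 (S, (S.transpose * U * S).diag)) :=
        (continuous_snd.prodMk hcd).tendsto (U, S)
      have h0 : ∑ i, ∑ j, |specGrad f S (S.transpose * U * S).diag i j - specGrad f R μ i j|
          < ε := by
        rw [hU.specGrad_eq hΓ hf hD hμ]
        simpa using hε
      have he1 : ∀ᶠ z : Mat n × Mat n in 𝓝 (U, S), (z.2.transpose * z.1 * z.2).diag ∈ Γ :=
        (hcd.tendsto (U, S)).eventually (hΓ.1.mem_nhds hmem)
      have he2 := hz.eventually
        ((continuousAt_sum_abs_specGrad_sub hΓ hf hmem (specGrad f R μ)).eventually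
          (gt_mem_nhds h0))
      filter_upwards [he1, he2] with z h1 h2 _
      exact ⟨h1, h2⟩
    · have hopen : IsOpen {z : Mat n × Mat n | z.2.transpose * z.1 * z.2 ≠
          Matrix.diagonal (z.2.transpose * z.1 * z.2).diag} :=
        isOpen_ne_fun hc hcd.matrix_diagonal
      filter_upwards [hopen.mem_nhds (x := (U, S)) hd] with z hz h
      exact absurd h hz

theorem specGrad_isSymm {n : ℕ} (f : (Fin n → ℝ) → ℝ) (R : Mat n)
    (μ : Fin n → ℝ) : (specGrad f R μ).IsSymm := by
  rw [Matrix.IsSymm, specGrad]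
  simp [Matrix.mul_assoc]

theorem sum_mul_symmetrize_sub {n : ℕ} {G U : Mat n} (hG : G.IsSymm) (hU : U.IsSymm)
    (h : Fin n → Fin n → ℝ) :
    ∑ i, ∑ j, G i j * ((h i j + h j i) / 2 - U i j) = ∑ i, ∑ j, G i j * (h i j - U i j) := by
  have hs : ∑ i, ∑ j, G i j * (h j i - U i j) = ∑ i, ∑ j, G i j * (h i j - U i j) := by
    rw [Finset.sum_comm]
    refine Finset.sum_congr rfl fun i _ => Finset.sum_congr rfl fun j _ => ?_
    rw [hG.apply, hU.apply]
  have h2 : ∑ i, ∑ j, G i j * ((h i j + h j i) / 2 - U i j)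
      = (∑ i, ∑ j, G i j * (h i j - U i j) + ∑ i, ∑ j, G i j * (h j i - U i j)) / 2 := by
    simp only [← Finset.sum_add_distrib, Finset.sum_div]
    refine Finset.sum_congr rfl fun i _ => Finset.sum_congr rfl fun j _ => ?_
    ring
  rw [h2, hs]
  ring

theorem abs_sum_mul_le {n : ℕ} (D X : Fin n → Fin n → ℝ) {c : ℝ} (hX : ∀ i j, |X i j| ≤ c) :
    |∑ i, ∑ j, D i j * X i j| ≤ (∑ i, ∑ j, |D i j|) * c := by
  simp only [Finset.sum_mul]
  refine (Finset.abs_sum_le_sum_abs _ _).trans (Finset.sum_le_sum fun i _ => ?_)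
  refine (Finset.abs_sum_le_sum_abs _ _).trans (Finset.sum_le_sum fun j _ => ?_)
  rw [abs_mul]
  exact mul_le_mul_of_nonneg_left (hX i j) (abs_nonneg _)

theorem Diagonalizes.hasFDerivAt_Ffunc {n : ℕ} {Γ : Set (Fin n → ℝ)} (hΓ : GoodCone Γ)
    {f : (Fin n → ℝ) → ℝ} (hf : SmoothSymF Γ f) (hf2 : F2cond Γ f) {U R : Mat n}
    {μ : Fin n → ℝ} (hU : Diagonalizes U R μ) (hμ : μ ∈ Γ) :
    HasFDerivAt (Ffunc f)
      (∑ i, ∑ j, specGrad f R μ i j • (ContinuousLinearMap.proj (R := ℝ) j).comp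
        (ContinuousLinearMap.proj (R := ℝ) (φ := fun _ : Fin n => Fin n → ℝ) i))
      (fun a b => U a b) := by
  refine HasFDerivAt.of_isLittleO (Asymptotics.isLittleO_iff.2 fun c hc => ?_)
  set sym : (Fin n → Fin n → ℝ) → Mat n := fun h => Matrix.of fun i j => (h i j + h j i) / 2
    with hsym
  have hsymm : ∀ h, (sym h).IsSymm := fun h => by
    ext i j
    simp [hsym, add_comm]
  have hsymU : sym (fun a b => U a b) = U := by
    ext i j
    simp [hsym, hU.isSymm.apply i j]
  have hcont : Continuous sym := by
    refine continuous_matrix fun i j => ?_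
    simp only [hsym, Matrix.of_apply]
    fun_prop
  have htend : Filter.Tendsto sym (𝓝 fun a b => U a b) (𝓝 U) := by
    simpa only [hsymU] using hcont.tendsto (fun a b => U a b)
  filter_upwards [htend.eventually (hU.eventually_specGrad_near hΓ hf hμ hc)] with h hh
  obtain ⟨S, hS⟩ := exists_diagonalizes_eigenVec (hsymm h)
  obtain ⟨hν, hnear⟩ := hh S _ hS
  have hFU : Ffunc f (fun a b => U a b) = f μ := by
    change f (eigenVec (sym fun a b => U a b)) = f μ
    rw [hsymU, hU.apply_eigenVec hf hμ]
  have hFh : Ffunc f h = f (eigenVec (sym h)) := rfl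
  have hup := hU.apply_le hΓ hf hf2 hS hμ hν
  have hlow := hS.apply_le hΓ hf hf2 hU hν hμ
  have hL : (∑ i, ∑ j, specGrad f R μ i j • (ContinuousLinearMap.proj (R := ℝ) j).comp
        (ContinuousLinearMap.proj (R := ℝ) (φ := fun _ : Fin n => Fin n → ℝ) i))
        (h - fun a b => U a b) = ∑ i, ∑ j, specGrad f R μ i j * (sym h i j - U i j) := by
    simp only [hsym, Matrix.of_apply]
    rw [sum_mul_symmetrize_sub (specGrad_isSymm f R μ) hU.isSymm h]
    simp
  have hX : ∀ i j, |sym h i j - U i j| ≤ ‖h - fun a b => U a b‖ := by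
    intro i j
    have h1 : ∀ i j, |h i j - U i j| ≤ ‖h - fun a b => U a b‖ := fun i j =>
      (norm_le_pi_norm ((h - fun a b => U a b) i) j).trans (norm_le_pi_norm _ i)
    have h2 := h1 i j
    have h3 := h1 j i
    rw [hU.isSymm.apply i j] at h3
    rw [abs_le] at h2 h3 ⊢
    simp only [hsym, Matrix.of_apply]
    constructor <;> linarith
  have hD := abs_sum_mul_le
    (fun i j => specGrad f S (eigenVec (sym h)) i j - specGrad f R μ i j)
    (fun i j => sym h i j - U i j) hX
  have hsplit : ∑ i, ∑ j, specGrad f S (eigenVec (sym h)) i j * (U i j - sym h i j)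
      = -(∑ i, ∑ j, specGrad f R μ i j * (sym h i j - U i j))
        - ∑ i, ∑ j, (specGrad f S (eigenVec (sym h)) i j - specGrad f R μ i j)
          * (sym h i j - U i j) := by
    simp only [← Finset.sum_neg_distrib, ← Finset.sum_sub_distrib]
    refine Finset.sum_congr rfl fun i _ => Finset.sum_congr rfl fun j _ => ?_
    ring
  have hD' := hD.trans (mul_le_mul_of_nonneg_right hnear.le (norm_nonneg _))
  rw [hL, hFU, hFh, Real.norm_eq_abs, abs_le]
  rw [abs_le] at hD'
  have hpos : 0 ≤ c * ‖h - fun a b => U a b‖ := by positivity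
  constructor <;> linarith [hD'.1, hD'.2]

theorem Diagonalizes.Fmat_eq {n : ℕ} {Γ : Set (Fin n → ℝ)} (hΓ : GoodCone Γ)
    {f : (Fin n → ℝ) → ℝ} (hf : SmoothSymF Γ f) (hf2 : F2cond Γ f) {U R : Mat n}
    {μ : Fin n → ℝ} (hU : Diagonalizes U R μ) (hμ : μ ∈ Γ) : Fmat f U = specGrad f R μ := by
  ext i j
  rw [Fmat, Matrix.of_apply, (hU.hasFDerivAt_Ffunc hΓ hf hf2 hμ).fderiv]
  simp only [_root_.sum_apply, _root_.smul_apply,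
    ContinuousLinearMap.comp_apply, ContinuousLinearMap.proj_apply, smul_eq_mul]
  rw [Finset.sum_eq_single i, Finset.sum_eq_single j]
  · simp
  · intro b _ hb
    simp [hb]
  · simp
  · intro b _ hb
    simp [hb]
  · simp

theorem fderiv_slice {n : ℕ} {g : (Fin n → ℝ) × ℝ → ℝ} (hg : Differentiable ℝ g)
    (x v : Fin n → ℝ) (t : ℝ) :
    fderiv ℝ (fun y => g (y, t)) x v = fderiv ℝ g (x, t) (v, 0) := by
  have h : HasFDerivAt (fun y : Fin n → ℝ => (y, t))
      ((ContinuousLinearMap.id ℝ _).prod 0) x := (hasFDerivAt_id x).prodMk (hasFDerivAt_const t x)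
  have h2 : HasFDerivAt (fun y => g (y, t))
      ((fderiv ℝ g (x, t)).comp ((ContinuousLinearMap.id ℝ _).prod 0)) x :=
    HasFDerivAt.comp (f := fun y : Fin n → ℝ => (y, t)) x (hg (x, t)).hasFDerivAt h
  rw [h2.fderiv]
  simp

namespace RegN

variable {n : ℕ} {u w : (Fin n → ℝ) → ℝ → ℝ}

theorem contDiff (hu : RegN 2 u) : ContDiff ℝ 2 fun q : (Fin n → ℝ) × ℝ => u q.1 q.2 := hu

theorem contDiff_slice (hu : RegN 2 u) (t : ℝ) : ContDiff ℝ 2 fun y => u y t :=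
  hu.contDiff.comp (contDiff_id.prodMk contDiff_const)

theorem contDiff_time (hu : RegN 2 u) (x : Fin n → ℝ) : ContDiff ℝ 2 (u x) :=
  hu.contDiff.comp (contDiff_const.prodMk contDiff_id)

theorem contDiff_fderiv_apply (hu : RegN 2 u) (v : (Fin n → ℝ) × ℝ) :
    ContDiff ℝ 1 fun q => fderiv ℝ (fun q : (Fin n → ℝ) × ℝ => u q.1 q.2) q v :=
  (hu.contDiff.fderiv_right (m := 1) (by norm_num)).clm_apply contDiff_const

theorem continuous_sgrad (hu : RegN 2 u) :
    Continuous fun q : (Fin n → ℝ) × ℝ => sgrad (fun y => u y q.2) q.1 := by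
  refine continuous_pi fun i => ?_
  have h := fun q : (Fin n → ℝ) × ℝ =>
    fderiv_slice (hu.contDiff.differentiable (by norm_num)) q.1 (Pi.single i 1) q.2
  simp only [sgrad, h]
  exact (hu.contDiff_fderiv_apply _).continuous

theorem continuous_shess (hu : RegN 2 u) :
    Continuous fun q : (Fin n → ℝ) × ℝ => shess (fun y => u y q.2) q.1 := by
  refine continuous_matrix fun i j => ?_
  have h := fun (t : ℝ) (y : Fin n → ℝ) =>
    fderiv_slice (hu.contDiff.differentiable (by norm_num)) y (Pi.single j 1) t
  have h' := fun q : (Fin n → ℝ) × ℝ => fderiv_slice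
    ((hu.contDiff_fderiv_apply (Pi.single j 1, 0)).differentiable (by norm_num)) q.1
    (Pi.single i 1) q.2
  simp only [shess, Matrix.of_apply, h, h']
  exact ((hu.contDiff_fderiv_apply (Pi.single j 1, 0)).continuous_fderiv
    (by norm_num)).clm_apply continuous_const

theorem differentiable_fderiv_slice (hu : RegN 2 u) (t : ℝ) :
    Differentiable ℝ (fderiv ℝ fun y => u y t) :=
  ((hu.contDiff_slice t).fderiv_right (m := 1) (by norm_num)).differentiable (by norm_num)

theorem isSymm_shess (hu : RegN 2 u) (x : Fin n → ℝ) (t : ℝ) :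
    (shess (fun y => u y t) x).IsSymm := by
  ext i j
  have hs : IsSymmSndFDerivAt ℝ (fun y => u y t) x :=
    (hu.contDiff_slice t).contDiffAt.isSymmSndFDerivAt (by simp)
  have happ : ∀ v w : Fin n → ℝ, fderiv ℝ (fun y => fderiv ℝ (fun y => u y t) y v) x w
      = fderiv ℝ (fderiv ℝ fun y => u y t) x w v := by
    intro v w
    rw [fderiv_clm_apply (hu.differentiable_fderiv_slice t x) (differentiableAt_const v)]
    simp
  simp only [Matrix.transpose_apply, shess, Matrix.of_apply, happ]
  exact hs _ _

theorem sgrad_sub (hw : RegN 2 w) (hu : RegN 2 u) (x : Fin n → ℝ) (t : ℝ) :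
    sgrad (fun y => w y t - u y t) x = sgrad (fun y => w y t) x - sgrad (fun y => u y t) x := by
  ext i
  have h := fderiv_fun_sub ((hw.contDiff_slice t).differentiable (by norm_num) x)
    ((hu.contDiff_slice t).differentiable (by norm_num) x)
  simp [sgrad, h]

theorem shess_sub (hw : RegN 2 w) (hu : RegN 2 u) (x : Fin n → ℝ) (t : ℝ) :
    shess (fun y => w y t - u y t) x = shess (fun y => w y t) x - shess (fun y => u y t) x := by
  ext i j
  have h := fun y => fderiv_fun_sub ((hw.contDiff_slice t).differentiable (by norm_num) y)
    ((hu.contDiff_slice t).differentiable (by norm_num) y)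
  have h' := fderiv_fun_sub (𝕜 := ℝ) (x := x)
    ((hw.differentiable_fderiv_slice t x).clm_apply
      (differentiableAt_const (Pi.single j (1 : ℝ) : Fin n → ℝ)))
    ((hu.differentiable_fderiv_slice t x).clm_apply
      (differentiableAt_const (Pi.single j (1 : ℝ) : Fin n → ℝ)))
  simp [shess, h, h']

theorem deriv_time_sub (hw : RegN 2 w) (hu : RegN 2 u) (x : Fin n → ℝ) (t : ℝ) :
    deriv (fun s => w x s - u x s) t = deriv (w x) t - deriv (u x) t :=
  deriv_fun_sub ((hw.contDiff_time x).differentiable (by norm_num) t)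
    ((hu.contDiff_time x).differentiable (by norm_num) t)

theorem isSymm_Umat (hu : RegN 2 u) {A : (Fin n → ℝ) → ℝ → (Fin n → ℝ) → Mat n}
    (hA : ASmooth A) (x : Fin n → ℝ) (t : ℝ) : (Umat A u x t).IsSymm :=
  (hu.isSymm_shess x t).add (hA.1 _ _ _)

theorem continuous_Umat (hu : RegN 2 u) {A : (Fin n → ℝ) → ℝ → (Fin n → ℝ) → Mat n}
    (hA : ASmooth A) : Continuous fun q : (Fin n → ℝ) × ℝ => Umat A u q.1 q.2 := by
  refine hu.continuous_shess.add (continuous_matrix fun i j => ?_)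
  exact (hA.2 i j).continuous.comp (continuous_id.prodMk hu.continuous_sgrad)

end RegN

theorem exists_uniform_shift {n : ℕ} {X : Type*} [TopologicalSpace X] {Γ : Set (Fin n → ℝ)}
    (hΓ : GoodCone Γ) {f : (Fin n → ℝ) → ℝ} (hf : SmoothSymF Γ f) {B : X → Mat n}
    (hB : Continuous B) {Q : Set X} (hQ : IsCompact Q) (hadm : ∀ q ∈ Q, eigenVec (B q) ∈ Γ)
    {δ : ℝ} (hδ : 0 < δ) :
    ∃ ε > 0, ∀ q ∈ Q, ∀ R μ, Diagonalizes (B q) R μ →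
      (μ + fun _ => -ε) ∈ Γ ∧ f μ - δ ≤ f (μ + fun _ => -ε) := by
  have hc : Continuous fun z : X × Mat n => z.2.transpose * B z.1 * z.2 := by fun_prop
  have hcd : Continuous fun z : X × Mat n => (z.2.transpose * B z.1 * z.2).diag := hc.matrix_diag
  set C : Set (X × Mat n) := (Q ×ˢ {R : Mat n | R.transpose * R = 1}) ∩
    {z | z.2.transpose * B z.1 * z.2 = Matrix.diagonal (z.2.transpose * B z.1 * z.2).diag} with hC
  have hCc : IsCompact C :=
    (hQ.prod (isCompact_orthogonal n)).inter_right (isClosed_eq hc hcd.matrix_diagonal)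
  set K : Set (Fin n → ℝ) := (fun z : X × Mat n => (z.2.transpose * B z.1 * z.2).diag) '' C
    with hK
  have hKc : IsCompact K := hCc.image hcd
  have hKΓ : K ⊆ Γ := by
    rintro _ ⟨z, ⟨⟨hz1, hz2⟩, hz3⟩, rfl⟩
    have hD : Diagonalizes (B z.1) z.2 (z.2.transpose * B z.1 * z.2).diag :=
      diagonalizes_iff.2 ⟨hz2, hz3⟩
    exact (hD.mem_iff hΓ).1 (hadm _ hz1)
  have hmemK : ∀ q ∈ Q, ∀ R μ, Diagonalizes (B q) R μ → μ ∈ K := by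
    intro q hq R μ h
    refine ⟨(q, R), ⟨⟨hq, h.1⟩, ?_⟩, ?_⟩
    · simp [h.conj_eq]
    · simp [h.conj_eq]
  have hev : ∀ᶠ s in 𝓝 (0 : ℝ), ∀ μ ∈ K,
      (μ + fun _ => -s) ∈ Γ ∧ f μ - δ < f (μ + fun _ => -s) := by
    refine hKc.eventually_forall_of_forall_eventually fun μ hμ => ?_
    have hshift : Filter.Tendsto (fun z : ℝ × (Fin n → ℝ) => z.2 + fun _ => -z.1)
        (𝓝 (0, μ)) (𝓝 μ) := by
      have : Continuous fun z : ℝ × (Fin n → ℝ) => z.2 + fun _ => -z.1 := by fun_prop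
      have h := this.tendsto (0, μ)
      have h0 : (μ + fun _ => -(0 : ℝ)) = μ := by ext; simp
      rwa [h0] at h
    have hfc : ContinuousAt f μ := (hasFDerivAt_of_mem hΓ hf (hKΓ hμ)).continuousAt
    have h1 := hshift.eventually (hΓ.1.mem_nhds (hKΓ hμ))
    have h2 : Filter.Tendsto (fun z : ℝ × (Fin n → ℝ) => f (z.2 + fun _ => -z.1) - f z.2)
        (𝓝 (0, μ)) (𝓝 0) := by
      have h3 := (hfc.tendsto.comp hshift).sub
        (hfc.tendsto.comp (continuous_snd.tendsto ((0 : ℝ), μ)))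
      rwa [sub_self] at h3
    have h3 := h2.eventually (lt_mem_nhds (neg_lt_zero.2 hδ))
    filter_upwards [h1, h3] with z hz1 hz3
    exact ⟨hz1, by linarith⟩
  obtain ⟨r, hr, hball⟩ := Metric.eventually_nhds_iff.1 hev
  refine ⟨r / 2, half_pos hr, fun q hq R μ h => ?_⟩
  have hd : dist (r / 2) 0 < r := by
    rw [Real.dist_eq, sub_zero, abs_of_pos (half_pos hr)]
    exact half_lt_self hr
  obtain ⟨h1, h2⟩ := hball hd μ (hmemK q hq R μ h)
  exact ⟨h1, h2.le⟩

section Coefficients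

variable {n : ℕ} {A : (Fin n → ℝ) → ℝ → (Fin n → ℝ) → Mat n}
  {ψ : (Fin n → ℝ) → ℝ → ℝ → (Fin n → ℝ) → ℝ}

theorem ASmooth.differentiable (hA : ASmooth A) (x : Fin n → ℝ) (t : ℝ) (i j : Fin n) :
    Differentiable ℝ fun p => A x t p i j :=
  ((hA.2 i j).comp (contDiff_const (c := (x, t)).prodMk contDiff_id)).differentiable (by simp)

theorem PsiSmooth.differentiable_gradient (hψ : PsiSmooth ψ) (x : Fin n → ℝ) (t z : ℝ) :
    Differentiable ℝ fun p => ψ x t z p :=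
  (ContDiff.comp hψ (contDiff_const (c := (x, t)).prodMk
    (contDiff_const (c := z).prodMk contDiff_id))).differentiable (by simp)

theorem PsiSmooth.differentiable_value (hψ : PsiSmooth ψ) (x : Fin n → ℝ) (t : ℝ)
    (p : Fin n → ℝ) : Differentiable ℝ fun z => ψ x t z p :=
  (ContDiff.comp hψ (contDiff_const (c := (x, t)).prodMk
    (contDiff_id.prodMk (contDiff_const (c := p))))).differentiable (by simp)

theorem A4cond.antitone (hA4 : A4cond ψ) (hψ : PsiSmooth ψ) (x : Fin n → ℝ) (t : ℝ)
    (p : Fin n → ℝ) : Antitone fun z => ψ x t z p :=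
  antitone_of_deriv_nonpos (hψ.differentiable_value x t p) fun z => hA4 x t z p

theorem A2cond.psi_tangent_le (hA2 : A2cond A ψ) (hψ : PsiSmooth ψ) (x : Fin n → ℝ) (t z : ℝ)
    (p₀ p : Fin n → ℝ) :
    ψ x t z p₀ + fderiv ℝ (fun p => ψ x t z p) p₀ (p - p₀) ≤ ψ x t z p := by
  have h := (hA2.1 x t z).le_add_of_hasFDerivAt (Set.mem_univ p₀) (Set.mem_univ p)
    (hψ.differentiable_gradient x t z p₀).hasFDerivAt.fun_neg
  simp only [_root_.neg_apply] at h
  linarith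

theorem A2cond.matrix_le_tangent (hA2 : A2cond A ψ) (hA : ASmooth A) (x : Fin n → ℝ) (t : ℝ)
    (R : Mat n) {g : Fin n → ℝ} (hg : ∀ i, 0 ≤ g i) (p₀ p : Fin n → ℝ) :
    ∑ i, ∑ j, (R * Matrix.diagonal g * R.transpose) i j * (A x t p i j - A x t p₀ i j) ≤
      ∑ i, ∑ j, (R * Matrix.diagonal g * R.transpose) i j *
        fderiv ℝ (fun p => A x t p i j) p₀ (p - p₀) := by
  have hconc : ConcaveOn ℝ Set.univ fun p =>
      ∑ i, ∑ j, (R * Matrix.diagonal g * R.transpose) i j * A x t p i j := by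
    simp only [sum_conj_diagonal_mul, conj_apply_eq_qform]
    refine ⟨convex_univ, fun a _ b _ r s hr hs hrs => ?_⟩
    simp only [Finset.smul_sum, ← Finset.sum_add_distrib]
    refine Finset.sum_le_sum fun m _ => ?_
    have h := mul_le_mul_of_nonneg_left
      ((hA2.2 x t fun i => R i m).2 (Set.mem_univ a) (Set.mem_univ b) hr hs hrs) (hg m)
    simp only [smul_eq_mul] at h ⊢
    linarith
  have hd := HasFDerivAt.fun_sum (u := Finset.univ) fun i _ =>
    HasFDerivAt.fun_sum (u := Finset.univ) fun j _ =>
      ((hA.differentiable x t i j p₀).hasFDerivAt).const_mul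
        ((R * Matrix.diagonal g * R.transpose) i j)
  have h := hconc.le_add_of_hasFDerivAt (Set.mem_univ p₀) (Set.mem_univ p) hd
  simp only [_root_.sum_apply, _root_.smul_apply, smul_eq_mul] at h
  simp only [mul_sub, Finset.sum_sub_distrib]
  linarith

end Coefficients

theorem trace_specGrad {n : ℕ} (f : (Fin n → ℝ) → ℝ) {R : Mat n} (hR : R.transpose * R = 1)
    (μ : Fin n → ℝ) : ∑ i, specGrad f R μ i i = ∑ i, fLam f μ i := by
  have h := sum_conj_diagonal_mul R 1 (fLam f μ)
  simpa [hR, Matrix.one_apply, specGrad] using h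

theorem Lop_eq {n : ℕ} (f : (Fin n → ℝ) → ℝ) (A : (Fin n → ℝ) → ℝ → (Fin n → ℝ) → Mat n)
    (ψ : (Fin n → ℝ) → ℝ → ℝ → (Fin n → ℝ) → ℝ) (u v : (Fin n → ℝ) → ℝ → ℝ)
    (x : Fin n → ℝ) (t : ℝ) :
    Lop f A ψ u v x t =
      (∑ i, ∑ j, Fmat f (Umat A u x t) i j * shess (fun y => v y t) x i j)
      + (∑ i, ∑ j, Fmat f (Umat A u x t) i j *
          fderiv ℝ (fun p => A x t p i j) (sgrad (fun y => u y t) x) (sgrad (fun y => v y t) x))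
      - fderiv ℝ (fun p => ψ x t (u x t) p) (sgrad (fun y => u y t) x)
          (sgrad (fun y => v y t) x)
      - deriv (v x) t := by
  have hA : ∑ i, ∑ j, Fmat f (Umat A u x t) i j *
      fderiv ℝ (fun p => A x t p i j) (sgrad (fun y => u y t) x) (sgrad (fun y => v y t) x)
      = ∑ k, (∑ i, ∑ j, Fmat f (Umat A u x t) i j *
          fderiv ℝ (fun p => A x t p i j) (sgrad (fun y => u y t) x) (Pi.single k 1))
          * sgrad (fun y => v y t) x k := by
    simp only [fderiv_eq_sum_fLam _ _ (sgrad (fun y => v y t) x), Finset.sum_mul, Finset.mul_sum]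
    rw [Finset.sum_comm' (t' := Finset.univ) (s' := fun _ => Finset.univ) (by simp)]
    rw [Finset.sum_congr rfl fun i _ => Finset.sum_comm, Finset.sum_comm]
    refine Finset.sum_congr rfl fun k _ => ?_
    rw [Finset.sum_comm]
    refine Finset.sum_congr rfl fun i _ => Finset.sum_congr rfl fun j _ => ?_
    rw [fLam, mul_assoc]
  rw [Lop, hA, fderiv_eq_sum_fLam _ _ (sgrad (fun y => v y t) x)]
  simp only [sub_mul, Finset.sum_sub_distrib, fLam]
  ring

/-- Theorem 2.1 of the paper, flat case: the strict subsolution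
gives `𝓛(u̲ − u) ≥ θ (1 + Σᵢ F^{ii})` for admissible solutions `u ≥ u̲`. -/
theorem statement0
    {n : ℕ} (hn : 2 ≤ n)
    (Ω : Set (Fin n → ℝ)) (hΩo : IsOpen Ω) (hΩb : Bornology.IsBounded Ω)
    (hΩs : SmoothBoundary Ω)
    (T : ℝ) (hT : 0 < T)
    (Γ : Set (Fin n → ℝ)) (hΓ : GoodCone Γ)
    (f : (Fin n → ℝ) → ℝ) (hfs : SmoothSymF Γ f) (hf1 : F1cond Γ f) (hf2 : F2cond Γ f)
    (A : (Fin n → ℝ) → ℝ → (Fin n → ℝ) → Mat n) (hA : ASmooth A)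
    (ψ : (Fin n → ℝ) → ℝ → ℝ → (Fin n → ℝ) → ℝ) (hψ : PsiSmooth ψ)
    (hA2 : A2cond A ψ) (hA4 : A4cond ψ)
    (δ₀ : ℝ) (hδ₀ : 0 < δ₀)
    (ub : (Fin n → ℝ) → ℝ → ℝ) (hubreg : RegN 2 ub)
    (hsub : Subsol Γ f A ψ δ₀ ub (QTbar Ω T)) :
    ∃ θ > 0, ∀ u : (Fin n → ℝ) → ℝ → ℝ,
      RegN 2 u → Admissible Γ A u (QTbar Ω T) → SolvesE f A ψ u (QT Ω T) →
      (∀ q ∈ QTbar Ω T, ub q.1 q.2 ≤ u q.1 q.2) →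
      ∀ q ∈ QT Ω T,
        Lop f A ψ u (fun x t => ub x t - u x t) q.1 q.2
          ≥ θ * (1 + ∑ i, Fmat f (Umat A u q.1 q.2) i i) := by

  have hQ : IsCompact (QTbar Ω T) := hΩb.isCompact_closure.prod isCompact_Icc
  obtain ⟨ε, hε, hshift⟩ := exists_uniform_shift hΓ hfs (hubreg.continuous_Umat hA) hQ
    hsub.1 (half_pos hδ₀)
  refine ⟨min (δ₀ / 2) ε, lt_min (half_pos hδ₀) hε, ?_⟩
  rintro u hu hadm hsol hle ⟨x, t⟩ hq
  have hqb : ((x, t) : (Fin n → ℝ) × ℝ) ∈ QTbar Ω T :=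
    ⟨subset_closure hq.1, Set.Ioc_subset_Icc_self hq.2⟩
  obtain ⟨R, hR⟩ := exists_diagonalizes_eigenVec (hu.isSymm_Umat hA x t)
  obtain ⟨S, hS⟩ := exists_diagonalizes_eigenVec (hubreg.isSymm_Umat hA x t)
  have hμ : eigenVec (Umat A u x t) ∈ Γ := hadm (x, t) hqb
  obtain ⟨hν, hfν⟩ := hshift (x, t) hqb S _ hS
  have hE := hsol (x, t) hq
  have hsubq := hsub.2 (x, t) hqb
  have hanti := hA4.antitone hψ x t (sgrad (fun y => ub y t) x) (hle (x, t) hqb)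
  have hG := hR.Fmat_eq hΓ hfs hf2 hμ
  have hsuper := hR.apply_le hΓ hfs hf2 (hS.add_smul_one (-ε)) hμ hν
  have hψt := hA2.psi_tangent_le hψ x t (u x t) (sgrad (fun y => u y t) x)
    (sgrad (fun y => ub y t) x)
  have hAt := hA2.matrix_le_tangent hA x t R (fun i => (hf1 _ hμ i).le)
    (sgrad (fun y => u y t) x) (sgrad (fun y => ub y t) x)
  have htr := trace_specGrad f hR.1 (eigenVec (Umat A u x t))
  have htr0 : 0 ≤ ∑ i, specGrad f R (eigenVec (Umat A u x t)) i i := by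
    rw [htr]
    exact Finset.sum_nonneg fun i _ => (hf1 _ hμ i).le
  have hsplit : ∑ i, ∑ j, specGrad f R (eigenVec (Umat A u x t)) i j *
        ((Umat A ub x t + (-ε) • (1 : Mat n)) i j - Umat A u x t i j)
      = (∑ i, ∑ j, specGrad f R (eigenVec (Umat A u x t)) i j *
          (shess (fun y => ub y t) x - shess (fun y => u y t) x) i j)
        + (∑ i, ∑ j, specGrad f R (eigenVec (Umat A u x t)) i j *
          (A x t (sgrad (fun y => ub y t) x) i j - A x t (sgrad (fun y => u y t) x) i j))
        - ε * ∑ i, specGrad f R (eigenVec (Umat A u x t)) i i := by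
    have h1 : ∑ i, specGrad f R (eigenVec (Umat A u x t)) i i
        = ∑ i, ∑ j, specGrad f R (eigenVec (Umat A u x t)) i j * (1 : Mat n) i j := by
      simp [Matrix.one_apply]
    rw [h1]
    simp only [Finset.mul_sum, ← Finset.sum_add_distrib, ← Finset.sum_sub_distrib]
    refine Finset.sum_congr rfl fun i _ => Finset.sum_congr rfl fun j _ => ?_
    simp only [Umat, Matrix.add_apply, Matrix.sub_apply, Matrix.smul_apply, smul_eq_mul]
    ring
  have hθ : min (δ₀ / 2) ε * (1 + ∑ i, specGrad f R (eigenVec (Umat A u x t)) i i)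
      ≤ δ₀ / 2 + ε * ∑ i, specGrad f R (eigenVec (Umat A u x t)) i i := by
    rw [mul_add, mul_one]
    exact add_le_add (min_le_left _ _) (mul_le_mul_of_nonneg_right (min_le_right _ _) htr0)
  rw [Lop_eq, hubreg.shess_sub hu, hubreg.sgrad_sub hu, hubreg.deriv_time_sub hu, hG]
  rw [hsplit] at hsuper
  change ∑ i, ∑ j, specGrad f R (eigenVec (Umat A u x t)) i j * _ ≤
    ∑ i, ∑ j, specGrad f R (eigenVec (Umat A u x t)) i j * _ at hAt
  dsimp only at hE hsubq hanti hfν ⊢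
  linarith

end ParabolicHessian
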